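/- For all real numbers a, b > 0 with a ≠ b, the inequality M(a,b) < (4/5)·(Q(a,b)/3 + 2·A(a,b)/3) + (1/5)·Q(a,b)^{1/3}·A(a,b)^{2/3} holds. -/

import Mathlib

noncomputable def M (a b : ℝ) : ℝ := (a - b) / (2 * Real.arsinh ((a - b) / (a + b)))
noncomputable def A (a b : ℝ) : ℝ := (a + b) / 2
noncomputable def Q (a b : ℝ) : ℝ := Real.sqrt ((a ^ 2 + b ^ 2) / 2)

/-- The real number `√(1 + x²) ^ (1/3)`. -/
noncomputable def cbrtSqrt (x : ℝ) : ℝ := (1 + x ^ 2) ^ ((1 : ℝ) / 6)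

theorem cbrtSqrt_pos (x : ℝ) : 0 < cbrtSqrt x := by
  unfold cbrtSqrt; positivity

theorem cbrtSqrt_pow_six (x : ℝ) : cbrtSqrt x ^ 6 = 1 + x ^ 2 := by
  unfold cbrtSqrt
  rw [← Real.rpow_mul_natCast (by positivity)]
  norm_num

theorem sqrt_one_add_sq_eq (x : ℝ) : √(1 + x ^ 2) = cbrtSqrt x ^ 3 := by
  rw [← cbrtSqrt_pow_six, show cbrtSqrt x ^ 6 = (cbrtSqrt x ^ 3) ^ 2 by ring]
  exact Real.sqrt_sq (pow_pos (cbrtSqrt_pos x) 3).le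

theorem one_lt_cbrtSqrt {x : ℝ} (hx : 0 < x) : 1 < cbrtSqrt x :=
  Real.one_lt_rpow (by nlinarith) (by norm_num)

theorem hasDerivAt_cbrtSqrt (x : ℝ) :
    HasDerivAt cbrtSqrt (x / (3 * cbrtSqrt x ^ 5)) x := by
  have hbase : HasDerivAt (fun y : ℝ => 1 + y ^ 2) (2 * x) x := by
    simpa using (hasDerivAt_pow 2 x).const_add 1
  have hpos : (0 : ℝ) < 1 + x ^ 2 := by positivity
  have h := hbase.rpow_const (p := (1 : ℝ) / 6) (Or.inl hpos.ne')
  refine h.congr_deriv ?_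
  have hc := (cbrtSqrt_pos x).ne'
  rw [Real.rpow_sub_one hpos.ne', ← cbrtSqrt, ← cbrtSqrt_pow_six]
  field_simp
  ring

theorem hasDerivAt_arsinh_sub_div (x : ℝ) :
    HasDerivAt
      (fun y => Real.arsinh y - y / ((4 * cbrtSqrt y ^ 3 + 3 * cbrtSqrt y + 8) / 15))
      ((cbrtSqrt x - 1) ^ 3 *
        (16 * cbrtSqrt x ^ 5 + 48 * cbrtSqrt x ^ 4 + 90 * cbrtSqrt x ^ 3 +
          86 * cbrtSqrt x ^ 2 + 45 * cbrtSqrt x + 15) /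
        (cbrtSqrt x ^ 5 * (4 * cbrtSqrt x ^ 3 + 3 * cbrtSqrt x + 8) ^ 2)) x := by
  have hc := cbrtSqrt_pos x
  have hd := hasDerivAt_cbrtSqrt x
  have hh : HasDerivAt (fun y => (4 * cbrtSqrt y ^ 3 + 3 * cbrtSqrt y + 8) / 15) _ x :=
    ((((hd.pow 3).const_mul 4).add (hd.const_mul 3)).add_const 8).div_const 15
  have hpos : 0 < 4 * cbrtSqrt x ^ 3 + 3 * cbrtSqrt x + 8 := by positivity
  refine ((Real.hasDerivAt_arsinh x).sub
    ((hasDerivAt_id x).div hh (by positivity))).congr_deriv ?_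
  have hx : x ^ 2 = cbrtSqrt x ^ 6 - 1 := by rw [cbrtSqrt_pow_six]; ring
  rw [sqrt_one_add_sq_eq]
  simp only [id]
  field_simp
  push_cast
  ring_nf
  rw [hx]
  ring

theorem div_lt_arsinh {x : ℝ} (hx : 0 < x) :
    x / ((4 * cbrtSqrt x ^ 3 + 3 * cbrtSqrt x + 8) / 15) < Real.arsinh x := by
  have hmono : StrictMonoOn
      (fun y => Real.arsinh y - y / ((4 * cbrtSqrt y ^ 3 + 3 * cbrtSqrt y + 8) / 15))
      (Set.Ici 0) := by
    refine strictMonoOn_of_deriv_pos (convex_Ici 0)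
      (fun y _ => (hasDerivAt_arsinh_sub_div y).continuousAt.continuousWithinAt) fun y hy => ?_
    rw [interior_Ici, Set.mem_Ioi] at hy
    rw [(hasDerivAt_arsinh_sub_div y).deriv]
    have hc := cbrtSqrt_pos y
    have hc1 : 0 < cbrtSqrt y - 1 := sub_pos.2 (one_lt_cbrtSqrt hy)
    positivity
  have h := hmono Set.self_mem_Ici hx.le hx
  simpa using h

theorem M_comm (a b : ℝ) : M a b = M b a := by
  unfold M
  rw [← neg_sub b a, add_comm a b, neg_div (b + a), Real.arsinh_neg, mul_neg, neg_div_neg_eq]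

theorem A_comm (a b : ℝ) : A a b = A b a := by
  unfold A; rw [add_comm]

theorem Q_comm (a b : ℝ) : Q a b = Q b a := by
  unfold Q; rw [add_comm]

theorem Q_eq_A_mul {a b : ℝ} (h : 0 < a + b) :
    Q a b = A a b * cbrtSqrt ((a - b) / (a + b)) ^ 3 := by
  have hA : 0 ≤ A a b := by unfold A; positivity
  rw [← sqrt_one_add_sq_eq, Q, ← Real.sqrt_sq hA, ← Real.sqrt_mul (sq_nonneg _), A]
  congr 1
  field_simp
  ring

theorem M_lt_of_lt {a b : ℝ} (hb : 0 < b) (hab : b < a) :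
    M a b < (4/5) * (Q a b / 3 + 2 * A a b / 3) +
      (1/5) * (Q a b ^ ((1 : ℝ)/3) * A a b ^ ((2 : ℝ)/3)) := by
  have hs : 0 < a + b := by linarith
  have hA : 0 < A a b := by unfold A; positivity
  have hx : 0 < (a - b) / (a + b) := div_pos (sub_pos.2 hab) hs
  have hM : M a b = A a b * ((a - b) / (a + b) / Real.arsinh ((a - b) / (a + b))) := by
    unfold M A
    field_simp
  rw [hM, Q_eq_A_mul hs]
  generalize (a - b) / (a + b) = x at hx ⊢
  generalize A a b = m at hA ⊢
  have hc := cbrtSqrt_pos x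
  have hG : (m * cbrtSqrt x ^ 3) ^ ((1 : ℝ)/3) * m ^ ((2 : ℝ)/3) = m * cbrtSqrt x := by
    rw [Real.mul_rpow hA.le (by positivity), ← Real.rpow_natCast_mul hc.le, mul_right_comm,
      ← Real.rpow_add hA]
    norm_num
  have hlt : x / Real.arsinh x < (4 * cbrtSqrt x ^ 3 + 3 * cbrtSqrt x + 8) / 15 := by
    rw [div_lt_comm₀ (Real.arsinh_pos_iff.2 hx) (by positivity)]
    exact div_lt_arsinh hx
  rw [hG]
  linarith [mul_lt_mul_of_pos_left hlt hA]

theorem stmt_1 (a b : ℝ) (ha : 0 < a) (hb : 0 < b) (hab : a ≠ b) :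
    M a b < (4/5) * (Q a b / 3 + 2 * A a b / 3) +
      (1/5) * (Q a b ^ ((1 : ℝ)/3) * A a b ^ ((2 : ℝ)/3)) := by
  rcases hab.lt_or_gt with h | h
  · rw [M_comm, Q_comm, A_comm]
    exact M_lt_of_lt ha h
  · exact M_lt_of_lt hb h
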